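/- Assume w_k ≠ 0 for every k ≥ 1. Then for every k ≥ 1, the real part of z_k equals 1 − 4w_k(I − 1)/(w_k − 1)². -/

import Mathlib

/-- The symmetric biquadratic `(1 - cx)² y² + (l x - 2c(x² + 1)) y + (c - x)²` whose level curve is
preserved by the recursion `x' x'' (1 - cx)² = (c - x)²`. -/
def biquad {K : Type*} [CommRing K] (c l x y : K) : K :=
  (1 - c * x) ^ 2 * y ^ 2 + (l * x - 2 * c * x ^ 2 - 2 * c) * y + (c - x) ^ 2

theorem biquad_comm {K : Type*} [CommRing K] (c l x y : K) :
    biquad c l x y = biquad c l y x := by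
  unfold biquad; ring

theorem biquad_sum_roots {K : Type*} [Field K] {c l x y y' : K} (hy : y ≠ 0)
    (h : biquad c l x y = 0) (hyy : y' * y * (1 - c * x) ^ 2 = (c - x) ^ 2) :
    (y' + y) * (1 - c * x) ^ 2 = 2 * c * x ^ 2 + 2 * c - l * x := by
  apply mul_right_cancel₀ hy
  unfold biquad at h
  linear_combination h + hyy

theorem biquad_other_root {K : Type*} [Field K] {c l x y y' : K} (hy : y ≠ 0)
    (h : biquad c l x y = 0) (hyy : y' * y * (1 - c * x) ^ 2 = (c - x) ^ 2) :
    biquad c l x y' = 0 := by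
  have hs := biquad_sum_roots hy h hyy
  unfold biquad
  linear_combination y' * hs - hyy

theorem biquad_orbit {K : Type*} [Field K] {c l : K} {x : ℕ → K} (hx : ∀ n, x n ≠ 0)
    (h0 : biquad c l (x 0) (x 1) = 0)
    (hrec : ∀ n, x (n + 2) * x n * (1 - c * x (n + 1)) ^ 2 = (c - x (n + 1)) ^ 2) (n : ℕ) :
    biquad c l (x n) (x (n + 1)) = 0 := by
  induction n with
  | zero => exact h0
  | succ n ih =>
    rw [biquad_comm] at ih
    exact biquad_other_root (hx n) ih (hrec n)

theorem biquad_one_ne_zero {c r : ℝ} (hr : 0 < r) (hcr : c + r < 1) (y : ℝ) :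
    biquad c (2 + 2 * c ^ 2 - 4 * r ^ 2) 1 y ≠ 0 := by
  intro h
  unfold biquad at h
  have h1 : (1 - c) ^ 2 * (y + 1) ^ 2 = 4 * r ^ 2 * y := by linear_combination h
  have hr2 : 0 < r ^ 2 := by positivity
  have h2 : r ^ 2 < (1 - c) ^ 2 := by gcongr; linarith
  have hy : 0 ≤ y := by
    by_contra! hy
    nlinarith [mul_nonneg (sq_nonneg (1 - c)) (sq_nonneg (y + 1)), mul_pos hr2 (neg_pos.2 hy)]
  nlinarith [mul_pos (sub_pos.2 h2) (show 0 < (y + 1) ^ 2 by positivity),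
    mul_nonneg hr2.le (sq_nonneg (y - 1))]

/-- The rational function expressing `Re z_k` through `w_k`. -/
noncomputable def reOf (c r x : ℝ) : ℝ :=
  1 - 4 * x * ((1 + c ^ 2 - r ^ 2) / (2 * c) - 1) / (x - 1) ^ 2

/-- The right-hand side of the recursion `u_{k+1} + u_{k-1} = G(u_k)` for `u_k = Re z_k`. -/
noncomputable def reSum (c r u : ℝ) : ℝ :=
  (4 * c * u - (2 + 2 * c ^ 2 - 4 * r ^ 2)) * (u - 2 * c + c ^ 2 * u) /
    (1 - 2 * c * u + c ^ 2) ^ 2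

theorem reOf_add_reOf {c r x y y' : ℝ} (hc : 0 < c)
    (hx : x ≠ 1) (hcx : 1 - c * x ≠ 0) (hy : y ≠ 1) (hy' : y' ≠ 1)
    (hsum : (y' + y) * (1 - c * x) ^ 2 =
      2 * c * x ^ 2 + 2 * c - (2 + 2 * c ^ 2 - 4 * r ^ 2) * x)
    (hprod : y' * y * (1 - c * x) ^ 2 = (c - x) ^ 2) :
    reOf c r y' + reOf c r y = reSum c r (reOf c r x) := by
  have hx1 : x - 1 ≠ 0 := sub_ne_zero.2 hx
  have hy1 : y - 1 ≠ 0 := sub_ne_zero.2 hy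
  have hy1' : y' - 1 ≠ 0 := sub_ne_zero.2 hy'
  set A := (1 - c * x) ^ 2 with hA
  have hA0 : A ≠ 0 := pow_ne_zero 2 hcx
  set D := (1 - c) ^ 2 * (x + 1) ^ 2 - 4 * r ^ 2 * x with hD
  have hAD : A * ((y' - 1) * (y - 1)) = D := by
    rw [hD]; linear_combination hprod - hsum + hA
  have hD0 : D ≠ 0 := hAD ▸ mul_ne_zero hA0 (mul_ne_zero hy1' hy1)
  have hsum' : y' + y = (2 * c * x ^ 2 + 2 * c - (2 + 2 * c ^ 2 - 4 * r ^ 2) * x) / A := by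
    rw [eq_div_iff hA0, hsum]
  have hprod' : y' * y = (c - x) ^ 2 / A := by rw [eq_div_iff hA0, hprod]
  have hden : (y' - 1) * (y - 1) = D / A := by rw [eq_div_iff hA0, ← hAD]; ring
  have hL : reOf c r y' + reOf c r y = 2 - 4 * ((1 + c ^ 2 - r ^ 2) / (2 * c) - 1) *
      ((y' * y) * (y' + y) - 4 * (y' * y) + (y' + y)) / ((y' - 1) * (y - 1)) ^ 2 := by
    unfold reOf; field_simp; ring
  have hG : 1 - 2 * c * reOf c r x + c ^ 2 = D / (x - 1) ^ 2 := by
    rw [hD]; unfold reOf; field_simp; ring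
  rw [hL, hsum', hprod', hden]
  unfold reSum
  rw [hG]
  unfold reOf
  field_simp
  rw [hA, hD]
  ring

theorem re_add_re_of_biquad {c r : ℝ} (hc : 0 < c) (hc1 : c < 1) {z y y' : ℂ} (hz : ‖z‖ = 1)
    (hsum : (y' + y) * (1 - c * z) ^ 2 =
      2 * c * z ^ 2 + 2 * c - ((2 + 2 * c ^ 2 - 4 * r ^ 2 : ℝ) : ℂ) * z) :
    y'.re + y.re = reSum c r z.re := by
  have hn : z.re * z.re + z.im * z.im = 1 := by
    rw [← Complex.normSq_apply, Complex.normSq_eq_norm_sq, hz]; norm_num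
  have hD : 1 - 2 * c * z.re + c ^ 2 ≠ 0 := by
    have : z.re ≤ 1 := hz ▸ Complex.re_le_norm z
    nlinarith [mul_le_mul_of_nonneg_left this hc.le, mul_pos (sub_pos.2 hc1) (sub_pos.2 hc1)]
  have hzz : z * (starRingEnd ℂ) z = 1 := by
    rw [Complex.mul_conj, Complex.normSq_eq_norm_sq, hz]; norm_num
  have hadd : z + (starRingEnd ℂ) z = 2 * (z.re : ℂ) := by
    rw [Complex.add_conj]; push_cast; ring
  generalize hq : (starRingEnd ℂ) z = q at hzz hadd
  have key : (y' + y) * (((1 - 2 * c * z.re + c ^ 2) ^ 2 : ℝ) : ℂ) =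
      ((4 * c * z.re - (2 + 2 * c ^ 2 - 4 * r ^ 2) : ℝ) : ℂ) *
        (z - ((2 * c : ℝ) : ℂ) + ((c ^ 2 : ℝ) : ℂ) * q) := by
    have hA : (1 - c * z) * (1 - c * q) = 1 - 2 * c * z.re + (c : ℂ) ^ 2 := by
      linear_combination (c : ℂ) ^ 2 * hzz - c * hadd
    have hB : z * (1 - c * q) ^ 2 = z - 2 * c + (c : ℂ) ^ 2 * q := by
      linear_combination ((c : ℂ) ^ 2 * q - 2 * c) * hzz
    have hC : 2 * c * z ^ 2 + 2 * c - ((2 + 2 * c ^ 2 - 4 * r ^ 2 : ℝ) : ℂ) * z =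
        z * (4 * c * z.re - ((2 + 2 * c ^ 2 - 4 * r ^ 2 : ℝ) : ℂ)) := by
      linear_combination 2 * c * z * hadd - 2 * c * hzz
    rw [hC] at hsum
    push_cast at hsum ⊢
    rw [← hA, ← hB]
    linear_combination (1 - c * q) ^ 2 * hsum
  have hre := congrArg Complex.re key
  rw [Complex.re_mul_ofReal, Complex.re_ofReal_mul, Complex.add_re, Complex.add_re,
    Complex.re_ofReal_mul, Complex.sub_re, Complex.ofReal_re, ← hq, Complex.conj_re] at hre
  unfold reSum
  rw [eq_div_iff (pow_ne_zero 2 hD), hre]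

theorem one_sub_ofReal_mul_ne_zero {c : ℝ} (hc : 0 < c) (hc1 : c < 1) {z : ℂ}
    (hz : ‖z‖ = 1) : 1 - (c : ℂ) * z ≠ 0 := by
  intro h
  have : ‖(c : ℂ) * z‖ = 1 := by rw [← sub_eq_zero.1 h, norm_one]
  rw [norm_mul, hz, Complex.norm_real, Real.norm_of_nonneg hc.le] at this
  linarith

theorem norm_ofReal_sub_eq {c : ℝ} {z : ℂ} (hz : ‖z‖ = 1) :
    ‖(c : ℂ) - z‖ = ‖1 - (c : ℂ) * z‖ := by
  have hn : z.re * z.re + z.im * z.im = 1 := by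
    rw [← Complex.normSq_apply, Complex.normSq_eq_norm_sq, hz]; norm_num
  rw [← sq_eq_sq₀ (norm_nonneg _) (norm_nonneg _), ← Complex.normSq_eq_norm_sq,
    ← Complex.normSq_eq_norm_sq]
  simp only [Complex.normSq_apply, Complex.sub_re, Complex.sub_im, Complex.mul_re, Complex.mul_im,
    Complex.ofReal_re, Complex.ofReal_im, Complex.one_re, Complex.one_im]
  linear_combination (1 - c ^ 2) * hn

theorem stmt15 (c r : ℝ) (hc : 0 < c) (hr : 0 < r) (hcr : c + r < 1)
    (I : ℝ) (hI : I = (1 + c ^ 2 - r ^ 2) / (2 * c))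
    (φ₁ : ℝ) (hφ₁ : φ₁ ∈ Set.Ioo 0 Real.pi)
    (hcos : Real.cos φ₁ = 2 * r ^ 2 / (1 - c) ^ 2 - 1)
    (z : ℤ → ℂ)
    (hzm1 : z (-1) = Complex.exp (-(φ₁ : ℂ) * Complex.I))
    (hz0 : z 0 = 1)
    (hzrec : ∀ k : ℤ, 0 ≤ k →
      z (k + 1) = ((c : ℂ) - z k) ^ 2 / (z (k - 1) * (1 - (c : ℂ) * z k) ^ 2))
    (w : ℕ → ℝ) (hw0 : w 0 = 0) (hw1 : w 1 = c)
    (hw2 : w 2 = 4 * c * r ^ 2 / (1 - c ^ 2) ^ 2)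
    (hwrec : ∀ k : ℕ, 2 ≤ k →
      w (k + 1) = (c - w k) ^ 2 / (w (k - 1) * (1 - c * w k) ^ 2))
    (hwnz : ∀ k : ℕ, 1 ≤ k → w k ≠ 0) :
    ∀ k : ℕ, 1 ≤ k →
      (z (k : ℤ)).re = 1 - 4 * w k * (I - 1) / (w k - 1) ^ 2 := by
  subst hI
  have hc1 : c < 1 := by linarith
  have hc1' : 1 - c ≠ 0 := by linarith
  have hc2 : 1 - c ^ 2 ≠ 0 := by nlinarith
  set l : ℝ := 2 + 2 * c ^ 2 - 4 * r ^ 2 with hl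
  -- the real orbit
  have hcw : ∀ k, 1 ≤ k → 1 - c * w k ≠ 0 := by
    intro k hk h
    rcases hk.eq_or_lt with rfl | hk
    · rw [hw1] at h
      exact hc2 (by linear_combination h)
    · exact hwnz (k + 1) (by omega) (by rw [hwrec k hk, h]; simp)
  have hwprod : ∀ n, w (n + 3) * w (n + 1) * (1 - c * w (n + 2)) ^ 2 = (c - w (n + 2)) ^ 2 := by
    intro n
    have h1 := hwnz (n + 1) (by omega)
    have h2 := hcw (n + 2) (by omega)
    have h3 := hwrec (n + 2) (by omega)
    rw [show n + 2 - 1 = n + 1 from rfl] at h3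
    rw [h3]
    field_simp
  have hwcurve : ∀ n, biquad c l (w (n + 1)) (w (n + 2)) = 0 := by
    refine biquad_orbit (x := fun n => w (n + 1)) (fun n => hwnz _ (by omega)) ?_ hwprod
    simp only [zero_add, Nat.reduceAdd]
    rw [hw1, hw2, hl]
    unfold biquad
    field_simp
    ring
  have hwsum : ∀ n, (w (n + 2) + w n) * (1 - c * w (n + 1)) ^ 2 =
      2 * c * w (n + 1) ^ 2 + 2 * c - l * w (n + 1) := by
    rintro (_ | n)
    · simp only [zero_add]
      rw [hw0, hw1, hw2, hl]
      field_simp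
      ring
    · exact biquad_sum_roots (hwnz _ (by omega)) ((biquad_comm _ _ _ _).trans (hwcurve n))
        (hwprod n)
  have hwprod' : ∀ n, w (n + 2) * w n * (1 - c * w (n + 1)) ^ 2 = (c - w (n + 1)) ^ 2 := by
    rintro (_ | n)
    · simp [hw0, hw1]
    · exact hwprod n
  have hwone : ∀ n, w n ≠ 1 := by
    rintro (_ | n) h
    · rw [hw0] at h
      exact zero_ne_one h
    · have hcurve := hwcurve n
      rw [h] at hcurve
      exact biquad_one_ne_zero hr hcr _ hcurve
  have hwre : ∀ n, reOf c r (w (n + 2)) + reOf c r (w n) = reSum c r (reOf c r (w (n + 1))) :=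
    fun n => reOf_add_reOf hc (hwone _) (hcw _ (by omega)) (hwone _) (hwone _)
      (hwsum n) (hwprod' n)
  -- the orbit on the unit circle
  have hzm1norm : ‖z (-1)‖ = 1 := by
    rw [hzm1, ← Complex.ofReal_neg, Complex.norm_exp_ofReal_mul_I]
  have hzstep : ∀ n : ℕ, z ((n : ℤ) + 1) =
      ((c : ℂ) - z n) ^ 2 / (z ((n : ℤ) - 1) * (1 - (c : ℂ) * z n) ^ 2) :=
    fun n => hzrec n (Int.natCast_nonneg n)
  have hznorm : ∀ n : ℕ, ‖z ((n : ℤ) - 1)‖ = 1 ∧ ‖z n‖ = 1 := by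
    intro n
    induction n with
    | zero => simpa [hz0] using hzm1norm
    | succ n ih =>
      push_cast
      rw [add_sub_cancel_right]
      refine ⟨ih.2, ?_⟩
      rw [hzstep n, norm_div, norm_mul, norm_pow, norm_pow, ih.1, norm_ofReal_sub_eq ih.2, one_mul]
      exact div_self (pow_ne_zero 2 (norm_ne_zero_iff.2
        (one_sub_ofReal_mul_ne_zero hc hc1 ih.2)))
  have hzne : ∀ n : ℕ, z ((n : ℤ) - 1) ≠ 0 := fun n =>
    norm_ne_zero_iff.1 (by rw [(hznorm n).1]; exact one_ne_zero)
  have hzprod : ∀ n : ℕ, z ((n : ℤ) + 1) * z ((n : ℤ) - 1) * (1 - c * z n) ^ 2 =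
      ((c : ℂ) - z n) ^ 2 := by
    intro n
    have h1 := hzne n
    have h2 := one_sub_ofReal_mul_ne_zero hc hc1 (hznorm n).2
    rw [hzstep n]
    field_simp
  have hzm1re : (z (-1)).re = 2 * r ^ 2 / (1 - c) ^ 2 - 1 := by
    rw [hzm1, ← Complex.ofReal_neg, Complex.exp_ofReal_mul_I_re, Real.cos_neg, hcos]
  have hzcurve : ∀ n : ℕ, biquad (c : ℂ) l (z ((n : ℤ) - 1)) (z n) = 0 := by
    intro n
    have key := biquad_orbit (x := fun n : ℕ => z ((n : ℤ) - 1)) (c := (c : ℂ)) (l := (l : ℂ))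
      hzne ?_ ?_ n
    · simpa using key
    · have hcj : z (-1) * (starRingEnd ℂ) (z (-1)) = 1 := by
        rw [Complex.mul_conj, Complex.normSq_eq_norm_sq, hzm1norm]; norm_num
      have hadd := Complex.add_conj (z (-1))
      rw [hzm1re] at hadd
      have hmul : (1 - c) ^ 2 * (2 * (2 * r ^ 2 / (1 - c) ^ 2 - 1)) = 4 * c - l := by
        rw [hl]; field_simp; ring
      have hmul' := congrArg (fun t : ℝ => (t : ℂ)) hmul
      simp only [Nat.cast_zero, Nat.cast_one, zero_sub, sub_self]
      rw [hz0, biquad_comm]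
      unfold biquad
      push_cast at hmul' hadd ⊢
      linear_combination -(1 - (c : ℂ)) ^ 2 * hcj + (1 - (c : ℂ)) ^ 2 * z (-1) * hadd
        + z (-1) * hmul'
    · intro n
      have h := hzprod n
      push_cast
      rw [show (n : ℤ) + 2 - 1 = n + 1 by ring, add_sub_cancel_right]
      exact h
  have hzre : ∀ n : ℕ, (z ((n : ℤ) + 1)).re + (z ((n : ℤ) - 1)).re = reSum c r (z n).re :=
    fun n => re_add_re_of_biquad hc hc1 (hznorm n).2
      (biquad_sum_roots (hzne n) ((biquad_comm _ _ _ _).trans (hzcurve n)) (hzprod n))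
  -- comparison of the two orbits
  have hre1 : reOf c r (w 1) = 2 * r ^ 2 / (1 - c) ^ 2 - 1 := by
    have : c - 1 ≠ 0 := by linarith
    rw [hw1, reOf, show (1 - c) ^ 2 = (c - 1) ^ 2 by ring]
    field_simp
    ring
  have hre0 : reOf c r (w 0) = 1 := by simp [reOf, hw0]
  have hz1re : (z 1).re = 2 * r ^ 2 / (1 - c) ^ 2 - 1 := by
    have hp := hzprod 0
    simp only [Nat.cast_zero, zero_add, zero_sub, hz0, mul_one] at hp
    have hcC : (1 - (c : ℂ)) ^ 2 ≠ 0 := by exact_mod_cast pow_ne_zero 2 hc1'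
    have hinv : z 1 * z (-1) = 1 :=
      mul_right_cancel₀ hcC (by linear_combination hp)
    rw [eq_inv_of_mul_eq_one_left hinv, Complex.inv_re, Complex.normSq_eq_norm_sq, hzm1norm,
      hzm1re]
    norm_num
  have main : ∀ n : ℕ, (z n).re = reOf c r (w n) ∧ (z ((n : ℤ) + 1)).re = reOf c r (w (n + 1)) := by
    intro n
    induction n with
    | zero => simp [hz0, hre0, hre1, hz1re]
    | succ n ih =>
      have h1 := hzre (n + 1)
      have h2 := hwre n
      push_cast at h1 ⊢
      rw [add_sub_cancel_right] at h1
      rw [ih.1, ih.2] at h1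
      exact ⟨ih.2, by linarith⟩
  exact fun k _ => (main k).1
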